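/- arXiv:1912.03562 — 2 statements merged into one kernel-verified Lean document; each statement's English description precedes it below -/
import Mathlib

section
/- Let R be a commutative domain, B an R-algebra, and S a multiplicative subset of B consisting of central regular elements of B. Then the localization BS^{-1} satisfies GKdim(BS^{-1}) = GKdim(B). -/
open TensorProduct Filter
open scoped ENNReal

/-- The rank of an `R`-module `M` over a commutative domain `R`:
the dimension over the field of fractions `Q = Frac(R)` of `Q ⊗[R] M`
(as a natural number; all modules to which this is applied are finitely generated,
so their rank is finite). -/
noncomputable def modRank (R : Type*) [CommRing R] [IsDomain R]
    (M : Type*) [AddCommGroup M] [Module R M] : ℕ :=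
  Module.finrank (FractionRing R) (FractionRing R ⊗[R] M)

/-- A frame of an `R`-algebra `B` is a finitely generated `R`-submodule of `B`
containing `1`. -/
def IsFrame (R : Type*) [CommRing R] {B : Type*} [Ring B] [Algebra R B]
    (V : Submodule R B) : Prop :=
  V.FG ∧ (1 : B) ∈ V

/-- The Gelfand-Kirillov dimension of an `R`-algebra `B` over a commutative domain `R`:
`GKdim(B) = sup_V limsup_{n → ∞} log_n (rank V^n)`, where `V` ranges over all
frames of `B`. -/
noncomputable def GKdim (R : Type*) [CommRing R] [IsDomain R]
    (B : Type*) [Ring B] [Algebra R B] : ℝ≥0∞ :=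
  ⨆ (V : Submodule R B) (_ : IsFrame R V),
    Filter.limsup
      (fun n : ℕ => ENNReal.ofReal (Real.logb n (modRank R ↥(V ^ n)))) Filter.atTop

theorem modRank_le_of_injective {R M N : Type*} [CommRing R] [IsDomain R]
    [AddCommGroup M] [Module R M] [AddCommGroup N] [Module R N] [Module.Finite R N]
    (f : M →ₗ[R] N) (hf : Function.Injective f) : modRank R M ≤ modRank R N :=
  LinearMap.finrank_le_finrank_of_injective (f := f.baseChange (FractionRing R))
    (Module.Flat.lTensor_preserves_injective_linearMap f hf)

theorem modRank_map_of_injective {R M N : Type*} [CommRing R] [IsDomain R]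
    [AddCommGroup M] [Module R M] [AddCommGroup N] [Module R N]
    (f : M →ₗ[R] N) (hf : Function.Injective f) (V : Submodule R M) :
    modRank R (V.map f) = modRank R V :=
  ((Submodule.equivMapOfInjective f hf V).baseChange R (FractionRing R)).finrank_eq.symm

theorem Real.logb_natCast_le_logb_natCast (n : ℕ) {k m : ℕ} (h : k ≤ m) :
    Real.logb n k ≤ Real.logb n m := by
  refine div_le_div_of_nonneg_right ?_ (Real.log_natCast_nonneg n)
  rcases Nat.eq_zero_or_pos k with rfl | hk
  · simpa using Real.log_natCast_nonneg m
  · exact Real.log_le_log (by exact_mod_cast hk) (by exact_mod_cast h)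

/-- To bound the Gelfand-Kirillov dimension of `A` by that of `B`, it suffices to dominate the
growth of every frame of `A` by the growth of a frame of `B`. -/
theorem GKdim_le_of_forall_frame {R A B : Type*} [CommRing R] [IsDomain R]
    [Ring A] [Algebra R A] [Ring B] [Algebra R B]
    (h : ∀ W : Submodule R A, IsFrame R W → ∃ V : Submodule R B, IsFrame R V ∧
      ∀ n : ℕ, modRank R ↥(W ^ n) ≤ modRank R ↥(V ^ n)) :
    GKdim R A ≤ GKdim R B := by
  refine iSup₂_le fun W hW => ?_
  obtain ⟨V, hV, hle⟩ := h W hW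
  refine le_iSup₂_of_le V hV (Filter.limsup_le_limsup (Eventually.of_forall fun n => ?_))
  exact ENNReal.ofReal_le_ofReal (Real.logb_natCast_le_logb_natCast n (hle n))

theorem GKdim_le_of_injective {R A B : Type*} [CommRing R] [IsDomain R]
    [Ring A] [Algebra R A] [Ring B] [Algebra R B]
    (f : A →ₐ[R] B) (hf : Function.Injective f) : GKdim R A ≤ GKdim R B := by
  refine GKdim_le_of_forall_frame fun W hW =>
    ⟨W.map f.toLinearMap, ⟨hW.1.map _, 1, hW.2, map_one f⟩, fun n => ?_⟩
  rw [← Submodule.map_pow, modRank_map_of_injective f.toLinearMap hf]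

namespace OreLocalization

variable {R B : Type*} [CommRing R] [Ring B] [Algebra R B] {S : Submonoid B} [OreSet S]

variable (R) in
/-- The `R`-linear map `b ↦ s⁻¹ b` from `B` to its localization. -/
noncomputable def divLinearMap (s : S) :
    B →ₗ[R] OreLocalization S B where
  toFun b := b /ₒ s
  map_add' _ _ := add_oreDiv.symm
  map_smul' r b := by
    rw [RingHom.id_apply, ← smul_one_oreDiv_one_smul r (b /ₒ s),
      oreDiv_smul_char (r • (1 : B)) b 1 s (r • (1 : B)) s (by simp)]
    simp

@[simp]
theorem divLinearMap_apply (s : S) (b : B) : divLinearMap R s b = b /ₒ s := rfl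

theorem oreDiv_left_injective (hreg : ∀ s ∈ S, IsRegular s) (s : S) :
    Function.Injective fun b : B => b /ₒ s := by
  intro a b hab
  obtain ⟨u, v, huv, hs⟩ := oreDiv_eq_iff.1 hab
  obtain rfl : (u : B) = v := (hreg s s.2).right hs
  exact ((hreg u u.2).left huv).symm

theorem oreDiv_mul_oreDiv_of_mem_center (hcentral : ∀ s ∈ S, s ∈ Set.center B)
    (a b : B) (s t : S) : (a /ₒ s) * (b /ₒ t) = (a * b) /ₒ (t * s) :=
  oreDiv_mul_char a b s t a t ((hcentral t t.2).comm a)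

theorem exists_le_map_divLinearMap (hcentral : ∀ s ∈ S, s ∈ Set.center B)
    (W : Submodule R (OreLocalization S B)) (hW : W.FG) :
    ∃ (s : S) (V : Submodule R B), V.FG ∧ W ≤ V.map (divLinearMap R s) := by
  induction W, hW using Submodule.fg_induction with
  | singleton x =>
    induction x with | _ b s
    refine ⟨s, R ∙ b, Submodule.fg_span_singleton b, ?_⟩
    rw [Submodule.map_span, Set.image_singleton, divLinearMap_apply]
  | sup W₁ W₂ _ _ h₁ h₂ =>
    obtain ⟨s, V₁, hV₁, hW₁⟩ := h₁
    obtain ⟨t, V₂, hV₂, hW₂⟩ := h₂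
    refine ⟨t * s, V₁.map (LinearMap.mulLeft R (t : B)) ⊔ V₂.map (LinearMap.mulLeft R (s : B)),
      (hV₁.map _).sup (hV₂.map _), ?_⟩
    rw [Submodule.map_sup]
    refine sup_le_sup (hW₁.trans ?_) (hW₂.trans ?_)
    · rintro _ ⟨b, hb, rfl⟩
      exact ⟨t * b, ⟨b, hb, rfl⟩, (OreLocalization.expand' b s t).symm⟩
    · rintro _ ⟨b, hb, rfl⟩
      have hst : t * s = s * t := Subtype.ext ((hcentral t t.2).comm s)
      rw [hst]
      exact ⟨s * b, ⟨b, hb, rfl⟩, (OreLocalization.expand' b t s).symm⟩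

theorem pow_le_map_divLinearMap (hcentral : ∀ s ∈ S, s ∈ Set.center B)
    {W : Submodule R (OreLocalization S B)} {V : Submodule R B} {s : S}
    (h : W ≤ V.map (divLinearMap R s)) (n : ℕ) :
    W ^ n ≤ (V ^ n).map (divLinearMap R (s ^ n)) := by
  induction n with
  | zero =>
    rw [pow_zero, pow_zero, pow_zero, Submodule.one_le]
    exact ⟨1, Submodule.one_le.1 le_rfl, OreLocalization.one_def.symm⟩
  | succ n ih =>
    rw [pow_succ, Submodule.mul_le]
    intro x hx y hy
    obtain ⟨a, ha, rfl⟩ := ih hx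
    obtain ⟨b, hb, rfl⟩ := h hy
    refine ⟨a * b, pow_succ V n ▸ Submodule.mul_mem_mul ha hb, ?_⟩
    rw [divLinearMap_apply, divLinearMap_apply, divLinearMap_apply,
      oreDiv_mul_oreDiv_of_mem_center hcentral, pow_succ']

end OreLocalization

/-- Let `B` be an `R`-algebra over a commutative domain `R` and let
`S` be a multiplicative subset of `B` consisting of central regular elements. Then the
localization `B S⁻¹` satisfies `GKdim(B S⁻¹) = GKdim(B)`. -/
theorem GKdim_oreLocalization (R : Type*) [CommRing R] [IsDomain R]
    (B : Type*) [Ring B] [Algebra R B]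
    (S : Submonoid B) [OreLocalization.OreSet S]
    (hcentral : ∀ s ∈ S, s ∈ Set.center B)
    (hreg : ∀ s ∈ S, IsRegular s) :
    GKdim R (OreLocalization S B) = GKdim R B := by
  apply le_antisymm
  · refine GKdim_le_of_forall_frame fun W hW => ?_
    obtain ⟨s, V, hV, hWV⟩ := OreLocalization.exists_le_map_divLinearMap hcentral W hW.1
    have hV₁ : (V ⊔ R ∙ (1 : B)).FG := hV.sup (Submodule.fg_span_singleton 1)
    refine ⟨V ⊔ R ∙ (1 : B), ⟨hV₁, Submodule.mem_sup_right (Submodule.mem_span_singleton_self 1)⟩,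
      fun n => ?_⟩
    have hle := OreLocalization.pow_le_map_divLinearMap hcentral
      (hWV.trans (Submodule.map_mono le_sup_left : _ ≤ (V ⊔ R ∙ (1 : B)).map _)) n
    rw [← modRank_map_of_injective (OreLocalization.divLinearMap R (s ^ n))
      (OreLocalization.oreDiv_left_injective hreg (s ^ n))]
    have : Module.Finite R (((V ⊔ R ∙ (1 : B)) ^ n).map (OreLocalization.divLinearMap R (s ^ n))) :=
      Module.Finite.iff_fg.2 ((hV₁.pow n).map _)
    exact modRank_le_of_injective _ (Submodule.inclusion_injective hle)
  · refine GKdim_le_of_injective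
      { OreLocalization.numeratorRingHom with commutes' := fun r => ?_ }
      (OreLocalization.oreDiv_left_injective hreg 1)
    rfl
end

section
/- Let R be a commutative domain and B an R-algebra equipped with an exhaustive increasing ℕ-filtration {F_p(B)}_{p∈ℕ} by R-submodules (F_p(B)·F_q(B) ⊆ F_{p+q}(B), 1 ∈ F_0(B)) which is locally finite, i.e. each F_p(B) is a finitely generated R-submodule of B. If the associated graded algebra Gr(B) = ⊕_{p} F_p(B)/F_{p-1}(B) is a finitely generated R-algebra, then GKdim(Gr(B)) = GKdim(B). -/
open TensorProduct Filter
open scoped ENNReal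

/-- The rank over a domain is the finrank over the domain itself. -/
lemma modRank_eq_finrank (R : Type*) [CommRing R] [IsDomain R]
    (M : Type*) [AddCommGroup M] [Module R M] : modRank R M = Module.finrank R M :=
  (TensorProduct.isBaseChange R M (FractionRing R)).finrank_eq

lemma modRank_mono {R M : Type*} [CommRing R] [IsDomain R] [AddCommGroup M] [Module R M]
    {N P : Submodule R M} (hP : P.FG) (h : N ≤ P) : modRank R N ≤ modRank R P := by
  have : Module.Finite R P := Module.Finite.iff_fg.mpr hP
  simpa only [modRank_eq_finrank] using Submodule.finrank_mono h

/-- A finitely generated submodule is contained in some step of an exhaustive filtration. -/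
lemma Submodule.FG.exists_le_of_monotone {R M : Type*} [CommRing R] [AddCommGroup M] [Module R M]
    {V : Submodule R M} (hV : V.FG) {F : ℕ → Submodule R M} (hmono : Monotone F)
    (hexh : (⨆ p, F p) = ⊤) : ∃ m, V ≤ F m := by
  obtain ⟨s, rfl⟩ := hV
  have hmem (x : M) : ∃ m, x ∈ F m := by
    rw [← Submodule.mem_iSup_of_directed F hmono.directed_le, hexh]
    trivial
  choose k hk using hmem
  exact ⟨s.sup k, Submodule.span_le.mpr fun x hx => hmono (Finset.le_sup hx) (hk x)⟩

/-- Rescaling the argument by a constant does not increase the polynomial growth rate. -/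
lemma limsup_logb_comp_mul_le {f : ℕ → ℕ} (hf : Monotone f) (m : ℕ) :
    limsup (fun n : ℕ => ENNReal.ofReal (Real.logb n (f (m * n)))) atTop ≤
      limsup (fun n : ℕ => ENNReal.ofReal (Real.logb n (f n))) atTop := by
  wlog hm : 0 < m generalizing m
  · refine le_trans (limsup_le_limsup ?_) (this 1 one_pos)
    filter_upwards [eventually_gt_atTop 1] with n hn
    refine ENNReal.ofReal_le_ofReal ?_
    rcases (f (m * n)).eq_zero_or_pos with h | h
    · simp only [h, Nat.cast_zero, Real.logb_zero]
      exact div_nonneg (Real.log_natCast_nonneg _) (Real.log_natCast_nonneg _)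
    · refine Real.logb_le_logb_of_le (by exact_mod_cast hn) (by exact_mod_cast h) ?_
      exact_mod_cast hf (Nat.mul_le_mul_right n (by omega))
  refine le_of_forall_gt_imp_ge_of_dense fun c hc => ?_
  obtain ⟨r, hLr, hrc⟩ := ENNReal.lt_iff_exists_nnreal_btwn.mp hc
  have hev := eventually_lt_of_limsup_lt hLr
  have hmul : Tendsto (fun n : ℕ => m * n) atTop atTop :=
    tendsto_id.const_mul_atTop' hm
  have hlim : Tendsto (fun n : ℕ => ENNReal.ofReal
      (r * (Real.log m / Real.log n + 1))) atTop (nhds r) := by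
    have h1 : Tendsto (fun n : ℕ => Real.log m / Real.log n) atTop (nhds 0) :=
      (Real.tendsto_log_atTop.comp tendsto_natCast_atTop_atTop).const_div_atTop _
    have h2 := ENNReal.tendsto_ofReal ((h1.add_const 1).const_mul (r : ℝ))
    simpa using h2
  refine limsup_le_of_le (by isBoundedDefault) ?_
  filter_upwards [hmul.eventually hev, hlim.eventually_lt_const hrc, eventually_gt_atTop 1]
    with n hn hn' hn1
  refine le_trans (ENNReal.ofReal_le_ofReal ?_) hn'.le
  have hlog : 0 < Real.log n := Real.log_pos (by exact_mod_cast hn1)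
  have hmn : 1 < m * n := lt_of_lt_of_le hn1 (Nat.le_mul_of_pos_left n hm)
  have hlogmn : 0 < Real.log (m * n : ℕ) := Real.log_pos (by exact_mod_cast hmn)
  have hlt : Real.logb (m * n : ℕ) (f (m * n)) < r := by
    have hnonneg : 0 ≤ Real.logb (m * n : ℕ) (f (m * n)) :=
      div_nonneg (Real.log_natCast_nonneg _) hlogmn.le
    exact (ENNReal.ofReal_lt_iff_lt_toReal hnonneg ENNReal.coe_ne_top).mp hn
  rw [Real.logb, div_lt_iff₀ hlogmn, Nat.cast_mul, Real.log_mul (by positivity)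
    (by positivity)] at hlt
  rw [Real.logb, div_le_iff₀ hlog]
  refine hlt.le.trans (le_of_eq ?_)
  field_simp

section Filtration

variable {R B : Type*} [CommRing R] [Ring B] [Algebra R B] {F : ℕ → Submodule R B}

lemma filtration_pow_le (hone : (1 : B) ∈ F 0) (hmul : ∀ p q : ℕ, F p * F q ≤ F (p + q))
    (m n : ℕ) : F m ^ n ≤ F (m * n) := by
  induction n with
  | zero => simpa [Submodule.one_le] using hone
  | succ n ih =>
    rw [pow_succ, Nat.mul_succ]
    exact (mul_le_mul_left ih _).trans (hmul _ _)

/-- If a filtration is generated in degrees `≤ m`, then `F n ⊆ (F m) ^ n`. -/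
lemma filtration_le_pow (hmono : Monotone F) (hone : (1 : B) ∈ F 0) {m : ℕ}
    (hgen : ∀ p, m < p → F p ≤ F (p - 1) ⊔ ⨆ d ∈ Finset.Icc 1 m, F d * F (p - d))
    {n : ℕ} (hn : 1 ≤ n) : F n ≤ F m ^ n := by
  have hone' : 1 ≤ F m := Submodule.one_le.mpr (hmono (Nat.zero_le m) hone)
  induction n using Nat.strong_induction_on with
  | _ n ih =>
    rcases le_or_gt n m with hnm | hnm
    · exact (hmono hnm).trans (le_self_pow hone' (by omega))
    · refine (hgen n hnm).trans (sup_le ?_ (iSup₂_le fun d hd => ?_))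
      · rcases Nat.eq_or_lt_of_le hn with rfl | hn1
        · exact (hmono (Nat.zero_le m)).trans (le_self_pow hone' one_ne_zero)
        · exact (ih (n - 1) (by omega) (by omega)).trans (pow_le_pow_right₀ hone' (by omega))
      · rw [Finset.mem_Icc] at hd
        calc F d * F (n - d) ≤ F m * F m ^ (n - d) :=
              mul_le_mul' (hmono hd.2) (ih (n - d) (by omega) (by omega))
          _ = F m ^ (n - d + 1) := (pow_succ' _ _).symm
          _ ≤ F m ^ n := pow_le_pow_right₀ hone' (by omega)

/-- The Gelfand-Kirillov dimension is the growth rate of any locally finite filtration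
generated in bounded degree. -/
lemma GKdim_eq_limsup_filtration [IsDomain R] (hmono : Monotone F)
    (hexh : (⨆ p, F p) = ⊤) (hone : (1 : B) ∈ F 0)
    (hmul : ∀ p q : ℕ, F p * F q ≤ F (p + q)) (hlocfin : ∀ p, (F p).FG) {m : ℕ}
    (hgen : ∀ p, m < p → F p ≤ F (p - 1) ⊔ ⨆ d ∈ Finset.Icc 1 m, F d * F (p - d)) :
    GKdim R B = limsup (fun n : ℕ => ENNReal.ofReal (Real.logb n (modRank R (F n)))) atTop := by
  have key {V W : ℕ → Submodule R B} (hW : ∀ n, (W n).FG) (hVW : ∀ n, 1 ≤ n → V n ≤ W n) :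
      limsup (fun n : ℕ => ENNReal.ofReal (Real.logb n (modRank R (V n)))) atTop ≤
        limsup (fun n : ℕ => ENNReal.ofReal (Real.logb n (modRank R (W n)))) atTop := by
    refine limsup_le_limsup ?_
    filter_upwards [eventually_gt_atTop 1] with n hn
    refine ENNReal.ofReal_le_ofReal ?_
    rcases (modRank R (V n)).eq_zero_or_pos with h | h
    · simp only [h, Nat.cast_zero, Real.logb_zero]
      exact div_nonneg (Real.log_natCast_nonneg _) (Real.log_natCast_nonneg _)
    · refine Real.logb_le_logb_of_le (by exact_mod_cast hn) (by exact_mod_cast h) ?_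
      exact_mod_cast modRank_mono (hW n) (hVW n hn.le)
  refine le_antisymm (iSup₂_le fun V hV => ?_) ?_
  · obtain ⟨k, hk⟩ := hV.1.exists_le_of_monotone hmono hexh
    refine (key (W := fun n => F (k * n)) (fun n => hlocfin _) fun n _ =>
      (pow_le_pow_left' hk n).trans (filtration_pow_le hone hmul k n)).trans ?_
    exact limsup_logb_comp_mul_le (f := fun n => modRank R (F n))
      (fun a b hab => modRank_mono (hlocfin b) (hmono hab)) k
  · refine le_trans ?_ (le_iSup₂ (F m) ⟨hlocfin m, hmono (Nat.zero_le m) hone⟩)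
    exact key (W := fun n => F m ^ n) (fun n => (hlocfin m).pow n)
      fun n hn => filtration_le_pow hmono hone hgen hn

end Filtration

lemma partialSups_fg {R M : Type*} [CommRing R] [AddCommGroup M] [Module R M]
    {ℬ : ℕ → Submodule R M} (hfg : ∀ p, (ℬ p).FG) (p : ℕ) : (partialSups ℬ p).FG := by
  induction p with
  | zero => simpa using hfg 0
  | succ p ih => simpa [partialSups_add_one] using ih.sup (hfg (p + 1))

section Graded

variable {R G : Type*} [CommRing R] [Ring G] [Algebra R G] (ℬ : ℕ → Submodule R G)
  [GradedRing ℬ]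

lemma partialSups_mul_le (p q : ℕ) :
    partialSups ℬ p * partialSups ℬ q ≤ partialSups ℬ (p + q) := by
  rw [partialSups_eq_biSup ℬ p, partialSups_eq_biSup ℬ q]
  simp only [Submodule.iSup_mul, Submodule.mul_iSup, iSup_le_iff]
  intro i hi j hj
  refine le_trans (Submodule.mul_le.mpr fun x hx y hy => ?_)
    (le_partialSups_of_le ℬ (add_le_add hj hi))
  exact SetLike.mul_mem_graded hx hy

lemma iSup_partialSups_grading : (⨆ p, partialSups ℬ p) = ⊤ := by
  rw [iSup_partialSups_eq]
  exact (DirectSum.Decomposition.isInternal ℬ).submodule_iSup_eq_top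

lemma disjoint_partialSups_grading (p : ℕ) : Disjoint (partialSups ℬ p) (ℬ (p + 1)) := by
  refine ((DirectSum.Decomposition.isInternal ℬ).submodule_iSupIndep (p + 1)).symm.mono_left ?_
  exact partialSups_le ℬ p _ fun j hj => le_iSup₂_of_le j (by omega) le_rfl

lemma finrank_partialSups_succ [IsDomain R] (hfg : ∀ p, (ℬ p).FG) (p : ℕ) :
    Module.finrank R (partialSups ℬ (p + 1) : Submodule R G) =
      Module.finrank R (partialSups ℬ p : Submodule R G) + Module.finrank R (ℬ (p + 1)) := by
  have h1 : Module.Finite R (ℬ (p + 1)) := Module.Finite.iff_fg.mpr (hfg _)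
  have h2 : Module.Finite R (partialSups ℬ p : Submodule R G) :=
    Module.Finite.iff_fg.mpr (partialSups_fg hfg p)
  have h := Submodule.rank_sup_add_rank_inf_eq (partialSups ℬ p) (ℬ (p + 1))
  rw [(disjoint_partialSups_grading ℬ p).eq_bot, rank_bot, add_zero] at h
  rw [partialSups_add_one, Module.finrank, h, Cardinal.toNat_add (Module.rank_lt_aleph0 R _)
    (Module.rank_lt_aleph0 R _)]
  rfl

/-- A finitely generated graded algebra is generated in bounded degree. -/
lemma exists_grading_le_iSup_mul (hGfg : Algebra.FiniteType R G) :
    ∃ m : ℕ, ∀ p, m < p → ℬ p ≤ ⨆ d ∈ Finset.Icc 1 m, ℬ d * ℬ (p - d) := by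
  obtain ⟨s, hs⟩ := hGfg.out
  obtain ⟨m, hm⟩ := (Submodule.fg_span s.finite_toSet (R := R)).exists_le_of_monotone
    (partialSups_monotone ℬ) (iSup_partialSups_grading ℬ)
  refine ⟨m, ?_⟩
  set T : ℕ → Submodule R G := fun p => ⨆ d ∈ Finset.Icc 1 m, ℬ d * ℬ (p - d) with hT
  let S : Submodule R G := ⨅ p, ⨅ (_ : m < p), (T p).comap (GradedAlgebra.proj ℬ p)
  have memS {x : G} : x ∈ S ↔ ∀ p, m < p → (DirectSum.decompose ℬ x p : G) ∈ T p := by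
    simp [S, Submodule.mem_iInf, GradedAlgebra.proj_apply]
  let A : Subalgebra R G :=
    { carrier := {a | ∀ x ∈ S, a * x ∈ S}
      mul_mem' := fun {a b} ha hb x hx => by rw [mul_assoc]; exact ha _ (hb _ hx)
      add_mem' := fun {a b} ha hb x hx => by
        rw [add_mul]; exact S.add_mem (ha _ hx) (hb _ hx)
      algebraMap_mem' := fun r x hx => by
        rw [← Algebra.smul_def]; exact S.smul_mem r hx }
  have zero_mul_T (p : ℕ) : ℬ 0 * T p ≤ T p := by
    simp only [hT, Submodule.mul_iSup]
    refine iSup₂_mono fun d _ => ?_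
    rw [← mul_assoc]
    refine mul_le_mul_left (Submodule.mul_le.mpr fun x hx y hy => ?_) _
    simpa using SetLike.mul_mem_graded hx hy
  have hA : partialSups ℬ m ≤ Subalgebra.toSubmodule A := by
    refine partialSups_le ℬ m _ fun i hi a ha x hx => memS.mpr fun p hp => ?_
    rw [DirectSum.coe_decompose_mul_of_left_mem_of_le ℬ ha (by omega : i ≤ p)]
    rcases i.eq_zero_or_pos with rfl | hi0
    · exact zero_mul_T p (Submodule.mul_mem_mul ha (memS.mp hx p hp))
    · exact Submodule.mem_iSup_of_mem i (Submodule.mem_iSup_of_mem (Finset.mem_Icc.mpr ⟨hi0, hi⟩)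
        (Submodule.mul_mem_mul ha (SetLike.coe_mem _)))
  have hAtop (a : G) : a ∈ A := by
    have : Algebra.adjoin R (s : Set G) ≤ A :=
      Algebra.adjoin_le fun x hx => hA (hm (Submodule.subset_span hx))
    exact this (hs ▸ Algebra.mem_top)
  have one_mem : (1 : G) ∈ S := memS.mpr fun p hp => by
    rw [DirectSum.decompose_of_mem_ne ℬ SetLike.GradedOne.one_mem (by omega : 0 ≠ p)]
    exact zero_mem _
  intro p hp x hx
  have := memS.mp (hAtop x 1 one_mem) p hp
  rwa [mul_one, DirectSum.decompose_of_mem_same ℬ hx] at this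

end Graded

/-- Let `B` be an `R`-algebra over a commutative domain `R`, equipped
with an exhaustive increasing `ℕ`-filtration `F` by `R`-submodules satisfying
`F p * F q ⊆ F (p + q)` and `1 ∈ F 0`, which is locally finite (each `F p` is a
finitely generated `R`-submodule).  Let `G`, with grading `ℬ`, be the associated graded
algebra `Gr(B) = ⊕_p F p / F (p-1)`: it is presented here as a graded `R`-algebra `G`
together with `R`-linear isomorphisms `e p : F p / F (p-1) ≃ ℬ p` compatible with the
multiplication induced by that of `B`.  If `Gr(B)` is a finitely generated `R`-algebra,
then `GKdim(Gr(B)) = GKdim(B)`. -/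
theorem GKdim_associatedGraded (R : Type*) [CommRing R] [IsDomain R]
    (B : Type*) [Ring B] [Algebra R B]
    (F : ℕ → Submodule R B) (hmono : Monotone F)
    (hexh : (⨆ p, F p) = ⊤) (hone : (1 : B) ∈ F 0)
    (hmul : ∀ p q : ℕ, F p * F q ≤ F (p + q))
    (hlocfin : ∀ p, (F p).FG)
    (G : Type*) [Ring G] [Algebra R G]
    (ℬ : ℕ → Submodule R G) [GradedRing ℬ]
    (e : ∀ p : ℕ, (↥(F p) ⧸
        (Submodule.comap (F p).subtype (if p = 0 then (⊥ : Submodule R B) else F (p - 1))))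
      ≃ₗ[R] ↥(ℬ p))
    (hcompat : ∀ (p q : ℕ) (x : ↥(F p)) (y : ↥(F q)),
      (e (p + q) (Submodule.Quotient.mk
          ⟨(x : B) * (y : B), hmul p q (Submodule.mul_mem_mul x.2 y.2)⟩) : G) =
        (e p (Submodule.Quotient.mk x) : G) * (e q (Submodule.Quotient.mk y) : G))
    (hGfg : Algebra.FiniteType R G) :
    GKdim R G = GKdim R B := by
  have quot_fg (p : ℕ) : (ℬ p).FG := by
    have : Module.Finite R (F p) := Module.Finite.iff_fg.mpr (hlocfin p)
    exact Module.Finite.iff_fg.mp (Module.Finite.equiv (e p))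
  have hrank (p : ℕ) :
      modRank R (partialSups ℬ p : Submodule R G) = modRank R (F p) := by
    simp only [modRank_eq_finrank]
    induction p with
    | zero =>
      have : Module.Finite R (F 0) := Module.Finite.iff_fg.mpr (hlocfin 0)
      rw [partialSups_zero, ← (e 0).finrank_eq, ← Submodule.finrank_quotient_add_finrank
        (Submodule.comap (F 0).subtype (if 0 = 0 then (⊥ : Submodule R B) else F (0 - 1)))]
      have hker : Submodule.comap (F 0).subtype ⊥ = ⊥ := Submodule.ker_subtype _
      rw [if_pos rfl, hker, finrank_bot, add_zero]
    | succ p ih =>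
      have : Module.Finite R (F (p + 1)) := Module.Finite.iff_fg.mpr (hlocfin (p + 1))
      rw [finrank_partialSups_succ ℬ quot_fg, ih, ← (e (p + 1)).finrank_eq,
        ← Submodule.finrank_quotient_add_finrank (Submodule.comap (F (p + 1)).subtype
          (if p + 1 = 0 then (⊥ : Submodule R B) else F (p + 1 - 1))), add_comm]
      congr 1
      rw [if_neg p.succ_ne_zero, Nat.add_sub_cancel]
      exact (Submodule.comapSubtypeEquivOfLe (hmono p.le_succ)).finrank_eq.symm
  obtain ⟨m, hm⟩ := exists_grading_le_iSup_mul ℬ hGfg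
  have genG (p : ℕ) (hp : m < p) : partialSups ℬ p ≤ partialSups ℬ (p - 1) ⊔
      ⨆ d ∈ Finset.Icc 1 m, partialSups ℬ d * partialSups ℬ (p - d) := by
    obtain ⟨q, rfl⟩ : ∃ q, p = q + 1 := ⟨p - 1, by omega⟩
    rw [partialSups_add_one]
    refine sup_le_sup le_rfl ((hm _ hp).trans (iSup₂_mono fun d _ => ?_))
    exact mul_le_mul' (le_partialSups ℬ d) (le_partialSups ℬ _)
  have genB (p : ℕ) (hp : m < p) :
      F p ≤ F (p - 1) ⊔ ⨆ d ∈ Finset.Icc 1 m, F d * F (p - d) := by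
    set N := F (p - 1) ⊔ ⨆ d ∈ Finset.Icc 1 m, F d * F (p - d)
    let N' : Submodule R G := ((N.comap (F p).subtype).map (Submodule.mkQ _)).map
      ((ℬ p).subtype ∘ₗ (e p).toLinearMap)
    have hle : ℬ p ≤ N' := by
      refine (hm p hp).trans (iSup₂_le fun d hd => Submodule.mul_le.mpr fun a ha b hb => ?_)
      have hdN : F d * F (p - d) ≤ N := le_sup_of_le_right (le_iSup₂_of_le d hd le_rfl)
      rw [Finset.mem_Icc] at hd
      obtain ⟨q, rfl⟩ : ∃ q, p = d + q := ⟨p - d, by omega⟩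
      rw [Nat.add_sub_cancel_left] at hb hdN
      obtain ⟨x, hx⟩ := Submodule.Quotient.mk_surjective _ ((e d).symm ⟨a, ha⟩)
      obtain ⟨y, hy⟩ := Submodule.Quotient.mk_surjective _ ((e q).symm ⟨b, hb⟩)
      have hxy := hcompat d q x y
      rw [hx, hy, LinearEquiv.apply_symm_apply, LinearEquiv.apply_symm_apply] at hxy
      rw [← hxy]
      exact Submodule.mem_map_of_mem (f := (ℬ (d + q)).subtype ∘ₗ (e (d + q)).toLinearMap)
        (Submodule.mem_map_of_mem (f := Submodule.mkQ _)
        (hdN (Submodule.mul_mem_mul x.2 y.2)))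
    intro x hx
    obtain ⟨_, ⟨y, hy, rfl⟩, hxy⟩ := hle (e p (Submodule.Quotient.mk ⟨x, hx⟩)).2
    have h := (e p).injective (Subtype.ext hxy)
    have h' := (Submodule.Quotient.eq _).mp h
    rw [if_neg (by omega : p ≠ 0)] at h'
    have h'' : (y : B) - x ∈ N := le_sup_left (a := F (p - 1)) h'
    simpa using N.sub_mem hy h''
  rw [GKdim_eq_limsup_filtration hmono hexh hone hmul hlocfin genB,
    GKdim_eq_limsup_filtration (partialSups_monotone ℬ) (iSup_partialSups_grading ℬ)
      (by simpa using SetLike.GradedOne.one_mem (A := ℬ)) (partialSups_mul_le ℬ)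
      (partialSups_fg quot_fg) genG]
  simp only [hrank]
end
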